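/- Let G be a König-Egerváry graph and let G₀ = G − N[core(G)] be the subgraph induced by the vertices lying outside the closed neighborhood of core(G). Then the following statements are equivalent: (i) G₀ has exactly one perfect matching; (ii) the α-critical edges of G₀ form a maximal matching of G₀; (iii) ξ(G) + η(G) = α(G); (iv) σ(G) + η(G) = μ(G); (v) ξ(G) + 2η(G) + σ(G) = |V(G)|. -/

import Mathlib

open scoped Classical

namespace KEG

variable {V : Type*}

/-- `S` is a stable (independent) set of vertices of `G`. -/
def IsStable (G : SimpleGraph V) (S : Finset V) : Prop :=
  ∀ ⦃x⦄, x ∈ S → ∀ ⦃y⦄, y ∈ S → ¬G.Adj x y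

/-- The stability number `α(G)`: maximum cardinality of a stable set. -/
noncomputable def alphaNum (G : SimpleGraph V) : ℕ :=
  sSup {n | ∃ S : Finset V, IsStable G S ∧ S.card = n}

/-- `S` is a maximum stable set of `G`. -/
def IsMaxStable (G : SimpleGraph V) (S : Finset V) : Prop :=
  IsStable G S ∧ S.card = alphaNum G

/-- `M` is a matching of `G`: a set of edges of `G`, pairwise non-incident. -/
def IsMatching (G : SimpleGraph V) (M : Finset (Sym2 V)) : Prop :=
  (∀ e ∈ M, e ∈ G.edgeSet) ∧
    ∀ e ∈ M, ∀ f ∈ M, e ≠ f → ∀ v : V, v ∈ e → v ∉ f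

/-- The matching number `μ(G)`: maximum cardinality of a matching. -/
noncomputable def muNum (G : SimpleGraph V) : ℕ :=
  sSup {n | ∃ M : Finset (Sym2 V), IsMatching G M ∧ M.card = n}

/-- A perfect matching: a matching covering every vertex. -/
def IsPerfectMatching (G : SimpleGraph V) (M : Finset (Sym2 V)) : Prop :=
  IsMatching G M ∧ ∀ v : V, ∃ e ∈ M, v ∈ e

/-- A maximal matching: a matching such that no edge of `G` can be added to it
while keeping pairwise non-incidence, i.e. every edge of `G` outside `M` is
incident to an edge of `M`. -/
def IsMaximalMatching (G : SimpleGraph V) (M : Finset (Sym2 V)) : Prop :=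
  IsMatching G M ∧ ∀ e ∈ G.edgeSet, e ∉ M → ∃ f ∈ M, ∃ v : V, v ∈ e ∧ v ∈ f

/-- `G` is a König-Egerváry graph: `α(G) + μ(G) = |V(G)|`. -/
def KonigEgervary (G : SimpleGraph V) [Fintype V] : Prop :=
  alphaNum G + muNum G = Fintype.card V

/-- `e` is an α-critical edge of `G`: `α(G - e) > α(G)`. -/
def IsAlphaCritical (G : SimpleGraph V) (e : Sym2 V) : Prop :=
  e ∈ G.edgeSet ∧ alphaNum G < alphaNum (G.deleteEdges {e})

/-- `e` is a μ-critical edge of `G`: `μ(G - e) < μ(G)`. -/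
def IsMuCritical (G : SimpleGraph V) (e : Sym2 V) : Prop :=
  e ∈ G.edgeSet ∧ muNum (G.deleteEdges {e}) < muNum G

/-- `core(G)`: the set of vertices belonging to every maximum stable set of `G`. -/
def core (G : SimpleGraph V) : Set V :=
  {v | ∀ S : Finset V, IsMaxStable G S → v ∈ S}

/-- `ξ(G) = |core(G)|`. -/
noncomputable def xi (G : SimpleGraph V) : ℕ := (core G).ncard

/-- `σ(G)`: the number of vertices belonging to no maximum stable set of `G`. -/
noncomputable def sigmaNum (G : SimpleGraph V) : ℕ :=
  {v : V | ∀ S : Finset V, IsMaxStable G S → v ∉ S}.ncard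

/-- `η(G)`: the number of α-critical edges of `G`. -/
noncomputable def eta (G : SimpleGraph V) : ℕ :=
  {e : Sym2 V | IsAlphaCritical G e}.ncard

/-- `N(A)`: the set of vertices adjacent to some vertex of `A`. -/
def nbhd (G : SimpleGraph V) (A : Set V) : Set V :=
  {v | ∃ a ∈ A, G.Adj a v}

/-- `N[A] = A ∪ N(A)`: the closed neighborhood of `A`. -/
def closedNbhd (G : SimpleGraph V) (A : Set V) : Set V :=
  A ∪ nbhd G A


lemma alpha_bdd [Fintype V] (G : SimpleGraph V) :
    BddAbove {n | ∃ S : Finset V, IsStable G S ∧ S.card = n} :=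
  ⟨Fintype.card V, by rintro n ⟨S, -, rfl⟩; exact Finset.card_le_univ S⟩

lemma card_le_alpha [Fintype V] {G : SimpleGraph V} {S : Finset V} (h : IsStable G S) :
    S.card ≤ alphaNum G := le_csSup (alpha_bdd G) ⟨S, h, rfl⟩

lemma exists_maxStable [Fintype V] (G : SimpleGraph V) : ∃ S, IsMaxStable G S := by
  have := Nat.sSup_mem (s := {n | ∃ S : Finset V, IsStable G S ∧ S.card = n})
    ⟨0, ∅, by intro x hx; simp at hx, rfl⟩ (alpha_bdd G)
  obtain ⟨S, h1, h2⟩ := this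
  exact ⟨S, h1, h2⟩

lemma exists_maxMatching [Fintype V] (G : SimpleGraph V) :
    ∃ M, IsMatching G M ∧ M.card = muNum G := by
  have := Nat.sSup_mem (s := {n | ∃ M : Finset (Sym2 V), IsMatching G M ∧ M.card = n})
    ⟨0, ∅, by simp [IsMatching], rfl⟩
    ⟨Fintype.card (Sym2 V), by rintro n ⟨S, -, rfl⟩; exact Finset.card_le_univ S⟩
  obtain ⟨S, h1, h2⟩ := this
  exact ⟨S, h1, h2⟩

lemma matching_unique {G : SimpleGraph V} {M : Finset (Sym2 V)} (hM : IsMatching G M)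
    {v a b : V} (ha : s(v, a) ∈ M) (hb : s(v, b) ∈ M) : a = b := by
  by_contra hne
  refine hM.2 _ ha _ hb ?_ v (by simp) (by simp)
  intro h
  rw [Sym2.congr_right] at h
  exact hne h

/-- structure of max matchings in KE graphs -/
lemma ke_structure [Fintype V] {G : SimpleGraph V} (hG : KonigEgervary G)
    {M : Finset (Sym2 V)} (hM : IsMatching G M) (hMc : M.card = muNum G)
    {S : Finset V} (hS : IsMaxStable G S) {v : V} (hv : v ∉ S) :
    ∃ w ∈ S, s(v, w) ∈ M := by
  have h1 : ∀ e ∈ M, ∃ u, u ∈ e ∧ u ∉ S := by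
    intro e he
    have hee := hM.1 e he
    induction e with
    | _ x y =>
      by_cases hx : x ∈ S
      · exact ⟨y, by simp, fun hy => hS.1 hx hy hee⟩
      · exact ⟨x, by simp, hx⟩
  haveI : Nonempty V := ⟨v⟩
  choose! f hf1 hf2 using h1
  have hinj : Set.InjOn f (M : Set (Sym2 V)) := by
    intro a ha b hb hab
    by_contra hne
    exact hM.2 a ha b hb hne (f a) (hf1 a ha) (hab ▸ hf1 b hb)
  have hsurj : M.image f = Sᶜ := by
    apply Finset.eq_of_subset_of_card_le
    · intro u hu
      obtain ⟨e, he, rfl⟩ := Finset.mem_image.1 hu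
      simpa using hf2 e he
    · rw [Finset.card_image_of_injOn hinj, Finset.card_compl]
      have := hS.2
      unfold KonigEgervary at hG
      omega
  have hv' : v ∈ M.image f := by rw [hsurj]; simpa using hv
  obtain ⟨e, he, hev⟩ := Finset.mem_image.1 hv'
  have hve := hf1 e he
  rw [hev] at hve
  obtain ⟨w, rfl⟩ := Sym2.mem_iff_exists.1 hve
  refine ⟨w, ?_, he⟩
  by_contra hw
  have hw' : w ∈ M.image f := by rw [hsurj]; simpa using hw
  obtain ⟨e', he', hew⟩ := Finset.mem_image.1 hw'
  have hwe := hf1 e' he'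
  rw [hew] at hwe
  have : e' = s(v, w) := by
    by_contra hne
    exact hM.2 _ he' _ he hne w hwe (by simp)
  rw [this, hev] at hew
  have := hM.1 _ he
  rw [hew] at this
  exact G.irrefl this

/-- facts on a stable set witnessing criticality -/
lemma crit_witness [Fintype V] {G : SimpleGraph V} {x y : V}
    (h : IsAlphaCritical G s(x, y)) :
    ∃ T, IsStable (G.deleteEdges {s(x, y)}) T ∧ alphaNum G < T.card ∧
      x ∈ T ∧ y ∈ T ∧ IsMaxStable G (T.erase x) ∧ IsMaxStable G (T.erase y) := by
  obtain ⟨hadj, hlt⟩ := h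
  obtain ⟨T, hT, hTc⟩ := exists_maxStable (G.deleteEdges {s(x, y)})
  have key : ∀ z, z = x ∨ z = y → IsStable G (T.erase z) := by
    intro z hz a ha b hb hab
    have ha' := Finset.mem_erase.1 ha
    have hb' := Finset.mem_erase.1 hb
    refine hT ha'.2 hb'.2 ?_
    rw [SimpleGraph.deleteEdges_adj]
    refine ⟨hab, ?_⟩
    simp only [Set.mem_singleton_iff, Sym2.eq_iff]
    grind
  have key2 : ∀ z, z = x ∨ z = y → z ∈ T := by
    intro z hz
    by_contra hzT
    have := card_le_alpha (key z hz)
    rw [Finset.erase_eq_of_notMem hzT] at this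
    omega
  have key3 : ∀ z, z = x ∨ z = y → IsMaxStable G (T.erase z) := by
    intro z hz
    refine ⟨key z hz, ?_⟩
    have h1 := card_le_alpha (key z hz)
    rw [Finset.card_erase_of_mem (key2 z hz)] at h1 ⊢
    omega
  exact ⟨T, hT, by omega, key2 x (.inl rfl), key2 y (.inr rfl), key3 x (.inl rfl),
    key3 y (.inr rfl)⟩

/-- partner function of a perfect matching -/
lemma pm_partner {H : SimpleGraph V} {M : Finset (Sym2 V)} (hM : IsPerfectMatching H M) :
    ∃ m : V → V, (∀ v, s(v, m v) ∈ M) ∧ (∀ v, m (m v) = v) ∧ (∀ v, H.Adj v (m v)) := by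
  have : ∀ v, ∃ w, s(v, w) ∈ M := by
    intro v
    obtain ⟨e, he, hv⟩ := hM.2 v
    obtain ⟨w, rfl⟩ := Sym2.mem_iff_exists.1 hv
    exact ⟨w, he⟩
  choose m hm using this
  refine ⟨m, hm, fun v => ?_, fun v => hM.1.1 _ (hm v)⟩
  refine matching_unique hM.1 (hm (m v)) ?_
  rw [Sym2.eq_swap]; exact hm v

lemma pm_stable_bound [Fintype V] {H : SimpleGraph V} {M : Finset (Sym2 V)}
    (hM : IsPerfectMatching H M) {T : Finset V} (hT : IsStable H T) :
    2 * T.card ≤ Fintype.card V := by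
  obtain ⟨m, -, h2, h3⟩ := pm_partner hM
  have hinj : Function.Injective m := Function.LeftInverse.injective h2
  have h : T.image m ⊆ Tᶜ := by
    intro u hu
    obtain ⟨v, hv, rfl⟩ := Finset.mem_image.1 hu
    simp only [Finset.mem_compl]
    exact fun h => hT hv h (h3 v)
  have := Finset.card_le_card h
  rw [Finset.card_image_of_injective _ hinj, Finset.card_compl] at this
  have := Finset.card_le_univ T
  omega

lemma pm_card [Fintype V] {H : SimpleGraph V} {M : Finset (Sym2 V)}
    (hM : IsPerfectMatching H M) : 2 * M.card = Fintype.card V := by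
  have h : M.biUnion (fun e => e.toFinset) = Finset.univ := by
    ext v
    simp only [Finset.mem_biUnion, Sym2.mem_toFinset, Finset.mem_univ, iff_true]
    exact hM.2 v
  rw [← Finset.card_univ, ← h, Finset.card_biUnion]
  · rw [Finset.sum_congr rfl (g := fun _ => 2)]
    · simp [mul_comm]
    · intro e he
      exact Sym2.card_toFinset_of_not_isDiag e (H.not_isDiag_of_mem_edgeSet (hM.1.1 e he))
  · intro e he f hf hne
    rw [Function.onFun, Finset.disjoint_left]
    intro v hv
    simp only [Sym2.mem_toFinset] at hv ⊢
    exact hM.1.2 e he f hf hne v hv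

lemma crit_mem_pm [Fintype V] {H : SimpleGraph V} (hα : 2 * alphaNum H = Fintype.card V)
    {M : Finset (Sym2 V)} (hM : IsPerfectMatching H M) {e : Sym2 V}
    (he : IsAlphaCritical H e) : e ∈ M := by
  by_contra hne
  have hM' : IsPerfectMatching (H.deleteEdges {e}) M := by
    refine ⟨⟨fun f hf => ?_, hM.1.2⟩, hM.2⟩
    rw [SimpleGraph.edgeSet_deleteEdges]
    refine ⟨hM.1.1 f hf, ?_⟩
    rintro rfl
    exact hne hf
  obtain ⟨T, hT, hTc⟩ := exists_maxStable (H.deleteEdges {e})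
  have := pm_stable_bound hM' hT
  have := he.2
  omega

/-- main step: with a unique perfect matching every matching edge is critical -/
lemma unique_crit [Fintype V] {H : SimpleGraph V} (hα : 2 * alphaNum H = Fintype.card V)
    (hcov : ∀ v, ∃ S, IsMaxStable H S ∧ v ∈ S)
    {M : Finset (Sym2 V)} (hM : IsPerfectMatching H M)
    (huniq : ∀ M', IsPerfectMatching H M' → M' = M) {e : Sym2 V} (he : e ∈ M) :
    IsAlphaCritical H e := by
  obtain ⟨m, hm1, hm2, hm3⟩ := pm_partner hM
  have hinj : Function.Injective m := Function.LeftInverse.injective hm2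
  -- each max stable set contains exactly one of `v`, `m v`
  have hex : ∀ S, IsMaxStable H S → ∀ v, v ∉ S → m v ∈ S := by
    intro S hS v hv
    have h : S.image m = Sᶜ := by
      apply Finset.eq_of_subset_of_card_le
      · intro u hu
        obtain ⟨v, hv, rfl⟩ := Finset.mem_image.1 hu
        simp only [Finset.mem_compl]
        exact fun h => hS.1 hv h (hm3 v)
      · rw [Finset.card_image_of_injective _ hinj, Finset.card_compl]
        have := hS.2
        omega
    have : v ∈ S.image m := by rw [h]; simpa using hv
    obtain ⟨u, hu, rfl⟩ := Finset.mem_image.1 this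
    rwa [hm2]
  obtain ⟨x, y, rfl⟩ : ∃ x y, e = s(x, y) := by
    induction e with
    | _ x y => exact ⟨x, y, rfl⟩
  have hy : y = m x := matching_unique hM.1 he (hm1 x)
  subst hy
  refine ⟨hM.1.1 _ he, ?_⟩
  obtain ⟨S, hS, hxS⟩ := hcov x
  obtain ⟨S', hS', hyS'⟩ := hcov (m x)
  have hyS : m x ∉ S := fun h => hS.1 hxS h (hm3 x)
  -- Hall
  let t : S → Finset V := fun s => Finset.univ.filter
    (fun u => u ∉ S ∧ H.Adj s u ∧ ¬ (s.1 = x ∧ u = m x))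
  have hnoHall : ¬ ∃ f : S → V, Function.Injective f ∧ ∀ s, f s ∈ t s := by
    rintro ⟨f, hf, hft⟩
    have hft' : ∀ s, f s ∉ S ∧ H.Adj s (f s) ∧ ¬ (s.1 = x ∧ f s = m x) := by
      intro s; have := hft s; simpa [t] using this
    have hfs : Finset.univ.image f = Sᶜ := by
      apply Finset.eq_of_subset_of_card_le
      · intro u hu
        obtain ⟨v, -, rfl⟩ := Finset.mem_image.1 hu
        simpa using (hft' v).1
      · rw [Finset.card_image_of_injective _ hf, Finset.card_compl]
        have := hS.2
        simp
        omega
    let M' : Finset (Sym2 V) := Finset.univ.image (fun s : S => s(s.1, f s))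
    have hM' : IsPerfectMatching H M' := by
      refine ⟨⟨?_, ?_⟩, ?_⟩
      · intro e he
        obtain ⟨s, -, rfl⟩ := Finset.mem_image.1 he
        exact (hft' s).2.1
      · intro e he g hg hne v hve hvg
        obtain ⟨s, -, rfl⟩ := Finset.mem_image.1 he
        obtain ⟨r, -, rfl⟩ := Finset.mem_image.1 hg
        apply hne
        have hsr : s = r := by
          rw [Sym2.mem_iff] at hve hvg
          rcases hve with h1 | h1 <;> rcases hvg with h2 | h2
          · exact Subtype.ext (h1.symm.trans h2)
          · exact absurd (h1 ▸ s.2) (h2 ▸ (hft' r).1)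
          · exact absurd (h2 ▸ r.2) (h1 ▸ (hft' s).1)
          · exact hf (h1.symm.trans h2)
        rw [hsr]
      · intro v
        by_cases hv : v ∈ S
        · exact ⟨_, Finset.mem_image_of_mem _ (Finset.mem_univ ⟨v, hv⟩), by simp⟩
        · have : v ∈ Finset.univ.image f := by rw [hfs]; simpa using hv
          obtain ⟨s, -, rfl⟩ := Finset.mem_image.1 this
          exact ⟨_, Finset.mem_image_of_mem _ (Finset.mem_univ s), by simp⟩
    have heq := huniq M' hM'
    have h1 : s(x, f ⟨x, hxS⟩) ∈ M := by
      rw [← heq]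
      exact Finset.mem_image_of_mem (fun s : S => s(s.1, f s)) (Finset.mem_univ ⟨x, hxS⟩)
    have h2 := matching_unique hM.1 h1 he
    exact (hft' ⟨x, hxS⟩).2.2 ⟨rfl, h2⟩
  rw [← Finset.all_card_le_biUnion_card_iff_exists_injective] at hnoHall
  push Not at hnoHall
  obtain ⟨A0, hA0⟩ := hnoHall
  let A : Finset V := A0.map (Function.Embedding.subtype _)
  have hAS : ∀ a ∈ A, a ∈ S := by
    intro a ha
    obtain ⟨s, -, rfl⟩ := Finset.mem_map.1 ha
    exact s.2
  have hAc : A.card = A0.card := Finset.card_map _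
  have hNmem : ∀ a ∈ A, ∀ u, u ∉ S → H.Adj a u → ¬ (a = x ∧ u = m x) → u ∈ A0.biUnion t := by
    intro a ha u h1 h2 h3
    obtain ⟨s, hs, rfl⟩ := Finset.mem_map.1 ha
    refine Finset.mem_biUnion.2 ⟨s, hs, ?_⟩
    simp only [t, Finset.mem_filter, Finset.mem_univ, true_and]
    exact ⟨h1, h2, h3⟩
  have hmS : ∀ a ∈ S, m a ∉ S := fun a ha h => hS.1 ha h (hm3 a)
  have hsub : (A.image m).erase (m x) ⊆ A0.biUnion t := by
    intro u hu
    obtain ⟨hne, hu⟩ := Finset.mem_erase.1 hu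
    obtain ⟨a, ha, rfl⟩ := Finset.mem_image.1 hu
    exact hNmem a ha _ (hmS a (hAS a ha)) (hm3 a) (fun h => hne h.2)
  have hcA : (A.image m).card = A.card := Finset.card_image_of_injective _ hinj
  have hxA : x ∈ A := by
    by_contra hxA
    have : m x ∉ A.image m := by
      intro h
      obtain ⟨a, ha, hax⟩ := Finset.mem_image.1 h
      exact hxA (hinj hax ▸ ha)
    rw [Finset.erase_eq_of_notMem this] at hsub
    have := Finset.card_le_card hsub
    omega
  have hmxA : m x ∈ A.image m := Finset.mem_image_of_mem _ hxA
  have hNeq : (A.image m).erase (m x) = A0.biUnion t := by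
    apply Finset.eq_of_subset_of_card_le hsub
    rw [Finset.card_erase_of_mem hmxA]
    omega
  have hclosed : ∀ a ∈ A, ∀ u, u ∉ S → H.Adj a u → ¬ (a = x ∧ u = m x) →
      u ≠ m x ∧ u ∈ A.image m := by
    intro a ha u h1 h2 h3
    have := hNmem a ha u h1 h2 h3
    rw [← hNeq] at this
    exact Finset.mem_erase.1 this
  -- the new set
  let T0 : Finset V := A ∪ (S' \ A.image m)
  have hmxT0 : m x ∉ T0 := by
    simp only [T0, Finset.mem_union, Finset.mem_sdiff, not_or]
    exact ⟨fun h => hyS (hAS _ h), fun h => h.2 hmxA⟩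
  have hT0c : S'.card ≤ T0.card := by
    -- inject `S'` into `T0`
    let g : V → V := fun v => if v ∈ A.image m then m v else v
    apply Finset.card_le_card_of_injOn g
    · intro v hv
      have hv : v ∈ S' := hv
      show g v ∈ T0
      simp only [g, T0]
      split_ifs with h
      · obtain ⟨a, ha, rfl⟩ := Finset.mem_image.1 h
        rw [hm2]; exact Finset.mem_union_left _ ha
      · exact Finset.mem_union_right _ (Finset.mem_sdiff.2 ⟨hv, h⟩)
    · intro v hv w hw hvw
      have hv : v ∈ S' := hv
      have hw : w ∈ S' := hw
      simp only [g] at hvw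
      split_ifs at hvw with h1 h2 h2
      · exact hinj hvw
      · exact absurd (hm3 v) (hvw ▸ hS'.1 hv hw)
      · exact absurd (hm3 w) (hvw ▸ hS'.1 hw hv)
      · exact hvw
  have hAA : ∀ a ∈ A, ∀ b ∈ A, ¬ H.Adj a b := fun a ha b hb => hS.1 (hAS a ha) (hAS b hb)
  have hAB : ∀ a ∈ A, ∀ b ∈ S' \ A.image m, ¬ H.Adj a b := by
    intro a ha b hb hab
    obtain ⟨hb1, hb2⟩ := Finset.mem_sdiff.1 hb
    by_cases hbS : b ∈ S
    · exact hS.1 (hAS a ha) hbS hab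
    · by_cases h : a = x ∧ b = m x
      · exact hb2 (h.2 ▸ hmxA)
      · exact hb2 (hclosed a ha b hbS hab h).2
  have hAy : ∀ a ∈ A, H.Adj a (m x) → a = x := by
    intro a ha hab
    by_contra hne
    exact (hclosed a ha _ hyS hab (fun h => hne h.1)).1 rfl
  have hTst : IsStable (H.deleteEdges {s(x, m x)}) (insert (m x) T0) := by
    intro a ha b hb hab
    rw [SimpleGraph.deleteEdges_adj] at hab
    obtain ⟨hab, hnee⟩ := hab
    simp only [Set.mem_singleton_iff] at hnee
    simp only [T0, Finset.mem_insert, Finset.mem_union] at ha hb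
    rcases ha with rfl | ha | ha <;> rcases hb with rfl | hb | hb
    · exact H.irrefl hab
    · have := hAy b hb hab.symm
      subst this
      exact hnee Sym2.eq_swap
    · exact hS'.1 hyS' (Finset.mem_sdiff.1 hb).1 hab
    · have := hAy a ha hab
      subst this
      exact hnee rfl
    · exact hAA a ha b hb hab
    · exact hAB a ha b hb hab
    · exact hS'.1 (Finset.mem_sdiff.1 ha).1 hyS' hab
    · exact hAB b hb a ha hab.symm
    · exact hS'.1 (Finset.mem_sdiff.1 ha).1 (Finset.mem_sdiff.1 hb).1 hab
  have := card_le_alpha hTst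
  rw [Finset.card_insert_of_notMem hmxT0] at this
  have := hS'.2
  omega

/-- the equivalences for the graph `G₀` -/
lemma inner_equiv [Fintype V] {H : SimpleGraph V} (hα : 2 * alphaNum H = Fintype.card V)
    (hcov : ∀ v, ∃ S, IsMaxStable H S ∧ v ∈ S)
    {M : Finset (Sym2 V)} (hM : IsPerfectMatching H M) :
    ((∃! M' : Finset (Sym2 V), IsPerfectMatching H M') ↔
      {e : Sym2 V | IsAlphaCritical H e}.ncard = alphaNum H) ∧
    ((∃ M' : Finset (Sym2 V), (∀ e, e ∈ M' ↔ IsAlphaCritical H e) ∧ IsMaximalMatching H M') ↔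
      {e : Sym2 V | IsAlphaCritical H e}.ncard = alphaNum H) := by
  have hc := pm_card hM
  have hiff : {e : Sym2 V | IsAlphaCritical H e}.ncard = alphaNum H ↔
      ∀ e ∈ M, IsAlphaCritical H e := by
    have hsub : {e : Sym2 V | IsAlphaCritical H e} ⊆ (M : Set (Sym2 V)) :=
      fun e he => crit_mem_pm hα hM he
    have hMn : (M : Set (Sym2 V)).ncard = M.card := Set.ncard_coe_finset M
    constructor
    · intro h
      have := Set.eq_of_subset_of_ncard_le hsub (by omega) (Set.toFinite _)
      intro e he
      have he' : e ∈ (M : Set (Sym2 V)) := he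
      rw [← this] at he'
      exact he'
    · intro h
      have : {e : Sym2 V | IsAlphaCritical H e} = (M : Set (Sym2 V)) :=
        Set.Subset.antisymm hsub (fun e he => h e he)
      rw [this]; omega
  rw [hiff]
  refine ⟨⟨?_, ?_⟩, ⟨?_, ?_⟩⟩
  · intro hu e he
    exact unique_crit hα hcov hM (fun M' hM' => hu.unique hM' hM) he
  · intro h
    refine ⟨M, hM, fun M' hM' => ?_⟩
    symm
    apply Finset.eq_of_subset_of_card_le
    · exact fun e he => crit_mem_pm hα hM' (h e he)
    · have := pm_card hM'
      omega
  · rintro ⟨M', h1, h2⟩ e he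
    by_contra hne
    obtain ⟨f, hf, v, hve, hvf⟩ := h2.2 e (hM.1.1 e he) (fun h => hne ((h1 e).1 h))
    have hfM := crit_mem_pm hα hM ((h1 f).1 hf)
    refine hM.1.2 e he f hfM ?_ v hve hvf
    rintro rfl
    exact hne ((h1 _).1 hf)
  · intro h
    refine ⟨M, fun e => ⟨h e, fun he => crit_mem_pm hα hM he⟩, hM.1, fun e he hne => ?_⟩
    induction e with
    | _ x y =>
      obtain ⟨f, hf, hx⟩ := hM.2 x
      exact ⟨f, hf, x, by simp, hx⟩

/-- For a König-Egerváry graph `G` with `G₀ = G - N[core(G)]`, the following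
are equivalent: (i) `G₀` has exactly one perfect matching; (ii) the α-critical
edges of `G₀` form a maximal matching of `G₀`; (iii) `ξ(G) + η(G) = α(G)`;
(iv) `σ(G) + η(G) = μ(G)`; (v) `ξ(G) + 2η(G) + σ(G) = |V(G)|`. -/
theorem stmt_16 {V : Type*} [Fintype V] (G : SimpleGraph V)
    (hG : KonigEgervary G) (W : Set V) (hW : W = (closedNbhd G (core G))ᶜ) :
    List.TFAE
      [∃! M : Finset (Sym2 ↥W), IsPerfectMatching (G.induce W) M,
       ∃ M : Finset (Sym2 ↥W),
         (∀ e : Sym2 ↥W, e ∈ M ↔ IsAlphaCritical (G.induce W) e) ∧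
           IsMaximalMatching (G.induce W) M,
       xi G + eta G = alphaNum G,
       sigmaNum G + eta G = muNum G,
       xi G + 2 * eta G + sigmaNum G = Fintype.card V] := by
  obtain ⟨M, hM, hMc⟩ := exists_maxMatching G
  obtain ⟨S0, hS0⟩ := exists_maxStable G
  set D : Set V := {v : V | ∀ S : Finset V, IsMaxStable G S → v ∉ S} with hD
  have hDN : nbhd G (core G) = D := by
    ext v
    constructor
    · rintro ⟨a, ha, hav⟩ S hS hv
      exact hS.1 (ha S hS) hv hav
    · intro hv
      obtain ⟨w, hw, hvw⟩ := ke_structure hG hM hMc hS0 (hv S0 hS0)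
      refine ⟨w, ?_, (hM.1 _ hvw : G.Adj v w).symm⟩
      intro S hS
      obtain ⟨w', hw', hvw'⟩ := ke_structure hG hM hMc hS (hv S hS)
      rwa [matching_unique hM hvw hvw']
  have hWmem : ∀ v, v ∈ W ↔ v ∉ core G ∧ v ∉ D := by
    intro v
    rw [hW, closedNbhd, hDN]
    simp
  have hCD : ∀ v, v ∈ core G → v ∉ D := fun v h1 h2 => h2 S0 hS0 (h1 S0 hS0)
  have hWm : ∀ v ∈ W, ∃ w ∈ W, s(v, w) ∈ M := by
    intro v hv
    obtain ⟨h1, h2⟩ := (hWmem v).1 hv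
    simp only [core, Set.mem_ofPred_eq, not_forall] at h1
    obtain ⟨S, hS, hvS⟩ := h1
    simp only [hD, Set.mem_ofPred_eq, not_forall, not_not] at h2
    obtain ⟨S', hS', hvS'⟩ := h2
    obtain ⟨w, hw, hvw⟩ := ke_structure hG hM hMc hS hvS
    refine ⟨w, (hWmem w).2 ⟨fun h => ?_, fun h => h S hS hw⟩, hvw⟩
    exact hS'.1 hvS' (h S' hS') (hM.1 _ hvw)
  -- perfect matching of G₀
  let M0 : Finset (Sym2 W) := Finset.univ.filter (fun e => e.map Subtype.val ∈ M)
  have hM0 : IsPerfectMatching (G.induce W) M0 := by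
    refine ⟨⟨?_, ?_⟩, ?_⟩
    · intro e he
      have he := (Finset.mem_filter.1 he).2
      induction e with
      | _ x y =>
        have : G.Adj x.1 y.1 := hM.1 _ he
        exact this
    · intro e he f hf hne v hve hvf
      have he := (Finset.mem_filter.1 he).2
      have hf := (Finset.mem_filter.1 hf).2
      refine hM.2 _ he _ hf ?_ v.1 (Sym2.mem_map.2 ⟨v, hve, rfl⟩) (Sym2.mem_map.2 ⟨v, hvf, rfl⟩)
      exact fun h => hne (Sym2.map.injective Subtype.val_injective h)
    · intro v
      obtain ⟨w, hw, hvw⟩ := hWm v.1 v.2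
      refine ⟨s(v, ⟨w, hw⟩), Finset.mem_filter.2 ⟨Finset.mem_univ _, hvw⟩, by simp⟩
  let C : Finset V := (core G).toFinset
  have hCx : C.card = xi G := by simp [C, xi, Set.ncard_eq_toFinset_card']
  have hC : ∀ v, v ∈ C ↔ v ∈ core G := fun v => by simp [C]
  -- lifting stable sets of `G₀`
  let up : Finset W → Finset V := fun T => T.map (Function.Embedding.subtype _) ∪ C
  have hupc : ∀ T, (up T).card = T.card + xi G := by
    intro T
    rw [← hCx, Finset.card_union_of_disjoint, Finset.card_map]
    rw [Finset.disjoint_left]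
    intro v hv hvC
    obtain ⟨s, -, rfl⟩ := Finset.mem_map.1 hv
    exact ((hWmem _).1 s.2).1 ((hC _).1 hvC)
  have hups : ∀ (F : Set (Sym2 W)) T, IsStable ((G.induce W).deleteEdges F) T →
      IsStable (G.deleteEdges (Sym2.map Subtype.val '' F)) (up T) := by
    have hCn : ∀ a ∈ C, ∀ b : V, b ∈ up Finset.univ → ¬ G.Adj a b := by
      intro a ha b hb hab
      have hbD : b ∈ D := by rw [← hDN]; exact ⟨a, (hC a).1 ha, hab⟩
      rcases Finset.mem_union.1 hb with hb | hb
      · obtain ⟨s, -, rfl⟩ := Finset.mem_map.1 hb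
        exact ((hWmem _).1 s.2).2 hbD
      · exact hCD b ((hC b).1 hb) hbD
    intro F T hT
    have hmono : up T ⊆ up Finset.univ :=
      Finset.union_subset_union (Finset.map_subset_map.2 (Finset.subset_univ _)) le_rfl
    intro a ha b hb hab
    rw [SimpleGraph.deleteEdges_adj] at hab
    obtain ⟨hab, hnF⟩ := hab
    by_cases haC : a ∈ C
    · exact hCn a haC b (hmono hb) hab
    by_cases hbC : b ∈ C
    · exact hCn b hbC a (hmono ha) hab.symm
    obtain ⟨s, hs, rfl⟩ := Finset.mem_map.1 ((Finset.mem_union.1 ha).resolve_right haC)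
    obtain ⟨r, hr, rfl⟩ := Finset.mem_map.1 ((Finset.mem_union.1 hb).resolve_right hbC)
    refine hT hs hr ?_
    rw [SimpleGraph.deleteEdges_adj]
    exact ⟨hab, fun h => hnF ⟨_, h, rfl⟩⟩
  -- restricting sets
  let dn : Finset V → Finset W := fun T => T.subtype (· ∈ W)
  have hdnc : ∀ T : Finset V, (∀ v ∈ core G, v ∈ T) → (∀ v ∈ D, v ∉ T) →
      (dn T).card + xi G = T.card := by
    intro T h1 h2
    rw [← hupc]
    congr 1
    ext v
    simp only [up, dn, Finset.mem_union, Finset.mem_map, Finset.mem_subtype,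
      Function.Embedding.subtype_apply, hC]
    constructor
    · rintro (⟨s, hs, rfl⟩ | h)
      · exact hs
      · exact h1 v h
    · intro hv
      by_cases hvc : v ∈ core G
      · exact .inr hvc
      · exact .inl ⟨⟨v, (hWmem v).2 ⟨hvc, fun h => h2 v h hv⟩⟩, hv, rfl⟩
  have hdns : ∀ (F : Set (Sym2 W)) T, IsStable (G.deleteEdges (Sym2.map Subtype.val '' F)) T →
      IsStable ((G.induce W).deleteEdges F) (dn T) := by
    intro F T hT a ha b hb hab
    rw [SimpleGraph.deleteEdges_adj] at hab
    refine hT (Finset.mem_subtype.1 ha) (Finset.mem_subtype.1 hb) ?_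
    rw [SimpleGraph.deleteEdges_adj]
    refine ⟨hab.1, ?_⟩
    rintro ⟨e, he, hee⟩
    have : e = s(a, b) := Sym2.map.injective Subtype.val_injective hee
    exact hab.2 (this ▸ he)
  have hups0 : ∀ T, IsStable (G.induce W) T → IsStable G (up T) := by
    intro T hT
    have := hups ∅ T (by simpa using hT)
    simpa using this
  have hdns0 : ∀ T, IsStable G T → IsStable (G.induce W) (dn T) := by
    intro T hT
    have := hdns ∅ T (by simpa using hT)
    simpa using this
  have hdnmax : ∀ T, IsMaxStable G T → (dn T).card + xi G = alphaNum G := by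
    intro T hT
    rw [← hT.2]
    exact hdnc T (fun v hv => hv T hT) (fun v hv => hv T hT)
  have hα0 : alphaNum (G.induce W) + xi G = alphaNum G := by
    apply le_antisymm
    · obtain ⟨T, hT⟩ := exists_maxStable (G.induce W)
      have := card_le_alpha (hups0 T hT.1)
      rw [hupc, hT.2] at this
      exact this
    · have := card_le_alpha (hdns0 S0 hS0.1)
      have := hdnmax S0 hS0
      omega
  have hα2 : 2 * alphaNum (G.induce W) = Fintype.card W := by
    obtain ⟨m, hm1, hm2, hm3⟩ := pm_partner hM0
    have hinj : Function.Injective m := Function.LeftInverse.injective hm2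
    have himg : (dn S0).image m = (dn S0)ᶜ := by
      ext u
      simp only [Finset.mem_image, Finset.mem_compl]
      constructor
      · rintro ⟨v, hv, rfl⟩ h
        exact hdns0 S0 hS0.1 hv h (hm3 v)
      · intro hu
        refine ⟨m u, ?_, hm2 u⟩
        have hu' : u.1 ∉ S0 := fun h => hu (Finset.mem_subtype.2 h)
        obtain ⟨w, hw, hvw⟩ := ke_structure hG hM hMc hS0 hu'
        have : s(u.1, (m u).1) ∈ M := (Finset.mem_filter.1 (hm1 u)).2
        rw [Finset.mem_subtype, matching_unique hM this hvw]
        exact hw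
    have h := congrArg Finset.card himg
    rw [Finset.card_image_of_injective _ hinj, Finset.card_compl] at h
    have := hdnmax S0 hS0
    have := Finset.card_le_univ (dn S0)
    omega
  have hcov : ∀ v, ∃ S, IsMaxStable (G.induce W) S ∧ v ∈ S := by
    intro v
    have h2 := ((hWmem v.1).1 v.2).2
    simp only [hD, Set.mem_ofPred_eq, not_forall, not_not] at h2
    obtain ⟨S, hS, hvS⟩ := h2
    refine ⟨dn S, ⟨hdns0 S hS.1, ?_⟩, Finset.mem_subtype.2 hvS⟩
    have := hdnmax S hS
    omega
  have heta : eta G = {e : Sym2 W | IsAlphaCritical (G.induce W) e}.ncard := by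
    rw [eta, ← Set.ncard_image_of_injective _ (Sym2.map.injective Subtype.val_injective)]
    congr 1
    ext e
    constructor
    · intro he
      induction e with
      | _ x y =>
        obtain ⟨T, hT, hTc, hx, hy, hTx, hTy⟩ := crit_witness he
        have hxy : G.Adj x y := he.1
        have hxW : x ∈ W := (hWmem x).2 ⟨fun h => by simpa using h _ hTx,
          fun h => h _ hTy (Finset.mem_erase.2 ⟨hxy.ne, hx⟩)⟩
        have hyW : y ∈ W := (hWmem y).2 ⟨fun h => by simpa using h _ hTy,
          fun h => h _ hTx (Finset.mem_erase.2 ⟨hxy.ne', hy⟩)⟩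
        refine ⟨s(⟨x, hxW⟩, ⟨y, hyW⟩), ⟨hxy, ?_⟩, rfl⟩
        have h1 := hdnc T (fun v hv => Finset.mem_of_mem_erase (hv _ hTx)) (by
          intro v hv hvT
          by_cases hvx : v = x
          · exact ((hWmem x).1 hxW).2 (hvx ▸ hv)
          · exact hv _ hTx (Finset.mem_erase.2 ⟨hvx, hvT⟩))
        have h2 := card_le_alpha (hdns {s(⟨x, hxW⟩, ⟨y, hyW⟩)} T (by simpa using hT))
        omega
    · rintro ⟨e, he, rfl⟩
      refine ⟨?_, ?_⟩
      · have := he.1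
        induction e with
        | _ x y => exact this
      · obtain ⟨T, hT⟩ := exists_maxStable ((G.induce W).deleteEdges {e})
        have h1 := card_le_alpha (hups {e} T hT.1)
        rw [Set.image_singleton, hupc, hT.2] at h1
        have := he.2
        omega
  have hn : xi G + sigmaNum G + Fintype.card W = Fintype.card V := by
    have h1 : (core G ∪ D).ncard = xi G + sigmaNum G :=
      Set.ncard_union_eq (Set.disjoint_left.2 hCD)
    have h2 : W = (core G ∪ D)ᶜ := by rw [hW, closedNbhd, hDN]
    have h3 := Set.ncard_add_ncard_compl (core G ∪ D)
    rw [← h2, h1] at h3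
    have h4 : W.ncard = Fintype.card W := by
      rw [← Nat.card_coe_set_eq, Nat.card_eq_fintype_card]
    rw [h4, Nat.card_eq_fintype_card] at h3
    exact h3
  obtain ⟨e1, e2⟩ := inner_equiv hα2 hcov hM0
  rw [← heta] at e1 e2
  unfold KonigEgervary at hG
  tfae_have 1 ↔ 3 := by rw [e1]; omega
  tfae_have 2 ↔ 3 := by rw [e2]; omega
  tfae_have 3 ↔ 4 := by omega
  tfae_have 3 ↔ 5 := by omega
  tfae_finish

end KEG
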